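/- Let N, M, U be positive integers, let Ā ∈ ℝ^{N×N} be a real symmetric matrix with eigenvalues λ_1, …, λ_N, and let B ≥ 0. Let ε be a transductive Rademacher vector with parameter p₀ = MU/(M+U)². Then E_ε[ sup_{w ∈ ℝ^N : ‖w‖₁ ≤ B} |Σ_{n=1}^N ε_n (Āw)_n| ] ≤ B · (√(2MU)/(M+U)) · Σ_{i=1}^{N} |λ_i|. -/

import Mathlib

open Finset

/-- Expectation with respect to a transductive Rademacher vector
`ε ∈ ℝ^N` with i.i.d. coordinates: `P(ε_i = 1) = P(ε_i = -1) = p`,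
`P(ε_i = 0) = 1 - 2p`. -/
noncomputable def tExp (N : ℕ) (p : ℝ) (f : (Fin N → ℝ) → ℝ) : ℝ :=
  ∑ s : Fin N → Fin 3,
    (∏ i, (![p, p, 1 - 2 * p] : Fin 3 → ℝ) (s i)) *
      f (fun i => (![(1 : ℝ), -1, 0]) (s i))

theorem tExp_mono {N : ℕ} {p : ℝ} (hp : 0 ≤ p) (hp' : 2 * p ≤ 1)
    {f g : (Fin N → ℝ) → ℝ} (h : ∀ ε, f ε ≤ g ε) : tExp N p f ≤ tExp N p g := by
  refine sum_le_sum fun s _ => mul_le_mul_of_nonneg_left (h _) (prod_nonneg fun i _ => ?_)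
  generalize s i = x
  fin_cases x <;> simp <;> linarith

theorem tExp_add {N : ℕ} {p : ℝ} (f g : (Fin N → ℝ) → ℝ) :
    tExp N p (fun ε => f ε + g ε) = tExp N p f + tExp N p g := by
  simp only [tExp, mul_add, sum_add_distrib]

theorem tExp_const_mul {N : ℕ} {p : ℝ} (a : ℝ) (f : (Fin N → ℝ) → ℝ) :
    tExp N p (fun ε => a * f ε) = a * tExp N p f := by
  simp only [tExp, mul_sum]
  exact sum_congr rfl fun s _ => by ring

theorem tExp_sum {N : ℕ} {p : ℝ} {ι : Type*} (t : Finset ι) (f : ι → (Fin N → ℝ) → ℝ) :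
    tExp N p (fun ε => ∑ i ∈ t, f i ε) = ∑ i ∈ t, tExp N p (f i) := by
  simp only [tExp, mul_sum]
  exact sum_comm

/-- Independence: the expectation of a product of functions of the coordinates factorizes. -/
theorem tExp_prod {N : ℕ} {p : ℝ} (f : Fin N → ℝ → ℝ) :
    tExp N p (fun ε => ∏ i, f i (ε i)) =
      ∏ i, (p * f i 1 + p * f i (-1) + (1 - 2 * p) * f i 0) := by
  have h := sum_prod_piFinset (univ : Finset (Fin 3)) fun (i : Fin N) x =>
    (![p, p, 1 - 2 * p] : Fin 3 → ℝ) x * f i ((![(1 : ℝ), -1, 0]) x)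
  simpa [tExp, prod_mul_distrib, Fin.sum_univ_three] using h

theorem tExp_const {N : ℕ} {p : ℝ} (a : ℝ) : tExp N p (fun _ => a) = a := by
  have h : tExp N p (fun _ => 1) = 1 := by
    have h := tExp_prod (N := N) (p := p) fun _ _ => 1
    simp only [prod_const_one] at h
    rw [h]
    exact prod_eq_one fun i _ => by ring
  simpa [h] using tExp_const_mul (N := N) (p := p) a fun _ => 1

theorem tExp_coord_mul_coord {N : ℕ} {p : ℝ} (i j : Fin N) :
    tExp N p (fun ε => ε i * ε j) = if i = j then 2 * p else 0 := by
  have h := tExp_prod (N := N) (p := p) fun k x =>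
    (if k = i then x else 1) * (if k = j then x else 1)
  simp only [prod_mul_distrib, prod_ite_eq', mem_univ, if_true] at h
  rw [h]
  split_ifs with hij
  · subst hij
    rw [prod_eq_single i]
    · simp
      ring
    · intro k _ hk
      simp [hk]
      ring
    · simp
  · exact prod_eq_zero (mem_univ i) (by simp [hij])

theorem tExp_dotProduct_sq {N : ℕ} {p : ℝ} (a : Fin N → ℝ) :
    tExp N p (fun ε => (ε ⬝ᵥ a) ^ 2) = 2 * p * ∑ i, a i ^ 2 := by
  have h (ε : Fin N → ℝ) :
      (ε ⬝ᵥ a) ^ 2 = ∑ i, ∑ j, a i * a j * (ε i * ε j) := by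
    rw [sq, dotProduct, sum_mul_sum]
    exact sum_congr rfl fun i _ => sum_congr rfl fun j _ => by ring
  simp only [h, tExp_sum, tExp_const_mul, tExp_coord_mul_coord, mul_ite, mul_zero,
    sum_ite_eq, mem_univ, if_true, mul_sum]
  exact sum_congr rfl fun i _ => by ring

/-- Jensen's inequality for a linear functional of a transductive Rademacher vector. -/
theorem tExp_abs_dotProduct_le {N : ℕ} {p : ℝ} (hp : 0 < p) (hp' : 2 * p ≤ 1)
    (a : Fin N → ℝ) (ha : ∑ i, a i ^ 2 = 1) :
    tExp N p (fun ε => |ε ⬝ᵥ a|) ≤ √(2 * p) := by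
  have hc : 0 < √(2 * p) := Real.sqrt_pos.2 (by positivity)
  have hc2 : √(2 * p) ^ 2 = 2 * p := Real.sq_sqrt (by positivity)
  set c := √(2 * p)
  calc tExp N p (fun ε => |ε ⬝ᵥ a|)
      ≤ tExp N p (fun ε => 1 / (2 * c) * (ε ⬝ᵥ a) ^ 2 + c / 2) := by
        refine tExp_mono hp.le hp' fun ε => ?_
        have h := div_nonneg (sq_nonneg (|ε ⬝ᵥ a| - c)) (mul_pos two_pos hc).le
        have : 1 / (2 * c) * (ε ⬝ᵥ a) ^ 2 + c / 2 - |ε ⬝ᵥ a| =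
            (|ε ⬝ᵥ a| - c) ^ 2 / (2 * c) := by
          rw [← sq_abs (ε ⬝ᵥ a)]
          field_simp
          ring
        linarith
    _ = c := by
        rw [tExp_add, tExp_const_mul, tExp_const, tExp_dotProduct_sq, ha, ← hc2]
        field_simp
        ring

open Matrix in
theorem Matrix.IsHermitian.dotProduct_mulVec_eq_sum {N : ℕ} {A : Matrix (Fin N) (Fin N) ℝ}
    (hA : A.IsHermitian) (x w : Fin N → ℝ) :
    x ⬝ᵥ A *ᵥ w = ∑ i, hA.eigenvalues i *
      (x ⬝ᵥ hA.eigenvectorBasis i) * (w ⬝ᵥ hA.eigenvectorBasis i) := by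
  have h := hA.eigenvectorBasis.sum_inner_mul_inner (WithLp.toLp 2 x) (WithLp.toLp 2 (A *ᵥ w))
  simp only [EuclideanSpace.inner_eq_star_dotProduct, star_trivial] at h
  rw [dotProduct_comm, ← h]
  refine sum_congr rfl fun i _ => ?_
  have hs : Aᵀ = A := by simpa using! hA.eq
  have hw : (A *ᵥ w) ⬝ᵥ hA.eigenvectorBasis i =
      hA.eigenvalues i * (w ⬝ᵥ hA.eigenvectorBasis i) := by
    rw [dotProduct_comm, dotProduct_mulVec, ← mulVec_transpose, hs, hA.mulVec_eigenvectorBasis,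
      smul_dotProduct, dotProduct_comm, smul_eq_mul]
  rw [hw, dotProduct_comm x]
  ring

theorem OrthonormalBasis.sum_sq_apply_eq_one {N : ℕ} {ι : Type*} [Fintype ι]
    (b : OrthonormalBasis ι ℝ (EuclideanSpace ℝ (Fin N))) (i : ι) :
    ∑ k, b i k ^ 2 = 1 := by
  have h := EuclideanSpace.norm_sq_eq (b i)
  rw [b.norm_eq_one] at h
  simpa using h.symm

theorem abs_dotProduct_le_sum_abs {N : ℕ} (w a : Fin N → ℝ) (ha : ∀ k, |a k| ≤ 1) :
    |w ⬝ᵥ a| ≤ ∑ k, |w k| := by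
  refine (abs_sum_le_sum_abs _ _).trans (sum_le_sum fun k _ => ?_)
  rw [abs_mul]
  exact mul_le_of_le_one_right (abs_nonneg _) (ha k)

/-- The support function of the `ℓ1` ball under a Hermitian matrix, bounded via its
eigendecomposition. -/
theorem sSup_abs_sum_mul_mulVec_le {N : ℕ} {A : Matrix (Fin N) (Fin N) ℝ} (hA : A.IsHermitian)
    {B : ℝ} (hB : 0 ≤ B) (ε : Fin N → ℝ) :
    sSup {y : ℝ | ∃ w : Fin N → ℝ,
        (∑ c, |w c| ≤ B) ∧ y = |∑ n, ε n * A.mulVec w n|} ≤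
      ∑ i, B * |hA.eigenvalues i| * |ε ⬝ᵥ hA.eigenvectorBasis i| := by
  refine Real.sSup_le ?_ (by positivity)
  rintro y ⟨w, hw, rfl⟩
  have h : ∑ n, ε n * A.mulVec w n = _ := hA.dotProduct_mulVec_eq_sum ε w
  rw [h]
  refine (abs_sum_le_sum_abs _ _).trans (sum_le_sum fun i _ => ?_)
  have hv : |w ⬝ᵥ hA.eigenvectorBasis i| ≤ B :=
    (abs_dotProduct_le_sum_abs w _ fun k => by
      rw [← sq_le_one_iff_abs_le_one, ← hA.eigenvectorBasis.sum_sq_apply_eq_one i]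
      exact single_le_sum (f := fun k => hA.eigenvectorBasis i k ^ 2)
        (fun _ _ => sq_nonneg _) (mem_univ k)).trans hw
  rw [abs_mul, abs_mul, mul_comm, ← mul_assoc]
  gcongr

/-- Bound on the Rademacher complexity of the direct adjacency-learning (LINK)
component at the transductive parameter `p₀ = MU/(M+U)²`, in terms of the
eigenvalue spectrum of the symmetric matrix `Ā`. -/
theorem rademacher_link_component_bound
    (N M U : ℕ) (hN : 0 < N) (hM : 0 < M) (hU : 0 < U)
    (A : Matrix (Fin N) (Fin N) ℝ) (hA : A.IsHermitian)
    (B : ℝ) (hB : 0 ≤ B) :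
    tExp N ((M : ℝ) * U / ((M : ℝ) + U) ^ 2) (fun ε =>
        sSup {y : ℝ | ∃ w : Fin N → ℝ,
          (∑ c, |w c| ≤ B) ∧ y = |∑ n, ε n * A.mulVec w n|})
      ≤ B * (Real.sqrt (2 * (M : ℝ) * U) / ((M : ℝ) + U)) *
          ∑ i, |hA.eigenvalues i| := by
  set p : ℝ := (M : ℝ) * U / ((M : ℝ) + U) ^ 2 with hp_def
  have hM' : (0 : ℝ) < M := by exact_mod_cast hM
  have hU' : (0 : ℝ) < U := by exact_mod_cast hU
  have hp : 0 < p := by positivity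
  have hp' : 2 * p ≤ 1 := by
    rw [hp_def, ← mul_div_assoc, div_le_one (by positivity)]
    nlinarith
  have hsqrt : √(2 * (M : ℝ) * U) / ((M : ℝ) + U) = √(2 * p) := by
    rw [hp_def, ← mul_div_assoc, ← mul_assoc, Real.sqrt_div (by positivity),
      Real.sqrt_sq (by positivity)]
  rw [hsqrt]
  calc _ ≤ tExp N p (fun ε =>
          ∑ i, B * |hA.eigenvalues i| * |ε ⬝ᵥ hA.eigenvectorBasis i|) :=
        tExp_mono hp.le hp' fun ε => sSup_abs_sum_mul_mulVec_le hA hB ε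
    _ = ∑ i, B * |hA.eigenvalues i| * tExp N p (fun ε => |ε ⬝ᵥ hA.eigenvectorBasis i|) := by
        simp only [tExp_sum, tExp_const_mul]
    _ ≤ ∑ i, B * |hA.eigenvalues i| * √(2 * p) := by
        gcongr with i
        exact tExp_abs_dotProduct_le hp hp' _ (hA.eigenvectorBasis.sum_sq_apply_eq_one i)
    _ = B * √(2 * p) * ∑ i, |hA.eigenvalues i| := by
        rw [mul_sum]
        exact sum_congr rfl fun i _ => by ring
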